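/- Let n ≥ 1. For every Boolean function f : (ZMod 2)^n → ZMod 2 there exist a constant c ∈ {0,1} ⊆ ZMod 2 and a finite set T ⊆ (ZMod 2)^n such that |T| + c ≤ 2^(n-1) (viewing c as the natural number 0 or 1) and f(x) = c + ∑_{a ∈ T} p_a(x) for all x ∈ (ZMod 2)^n. In particular, every Boolean function {0,1}^n → {0,1} can be represented by a polynomial of degree ≤ n with at most 2^(n-1) monomial terms. -/

import Mathlib

/-- The indicator polynomial function `p_a(x) = ∏ i, z_i` where `z_i = x_i` if
`a_i = 1` and `z_i = x_i + 1` if `a_i = 0`. -/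
def indicatorPoly {n : ℕ} (a x : Fin n → ZMod 2) : ZMod 2 :=
  ∏ i : Fin n, if a i = 1 then x i else x i + 1

theorem zmod_two_eq_zero_or_one (y : ZMod 2) : y = 0 ∨ y = 1 := by
  revert y
  decide

/-- `indicatorPoly a` is the indicator function of the point `a`. -/
theorem indicatorPoly_eq_ite {n : ℕ} (a x : Fin n → ZMod 2) :
    indicatorPoly a x = if x = a then 1 else 0 := by
  have factor : ∀ u v : ZMod 2, (if u = 1 then v else v + 1) = if v = u then 1 else 0 := by
    decide
  simp only [indicatorPoly, factor, Finset.prod_ite_zero, Finset.prod_const_one, funext_iff,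
    Finset.mem_univ, true_imp_iff]

theorem sum_indicatorPoly {n : ℕ} (T : Finset (Fin n → ZMod 2)) (x : Fin n → ZMod 2) :
    ∑ a ∈ T, indicatorPoly a x = if x ∈ T then 1 else 0 := by
  simp only [indicatorPoly_eq_ite, Finset.sum_ite_eq]

/-- Every Boolean function `{0,1}^n → {0,1}` (with `n ≥ 1`) can be written as
`c + ∑_{a ∈ T} p_a` with `c ∈ {0,1}` and `|T| + c ≤ 2^(n-1)`, i.e. it is
represented by a polynomial of degree `≤ n` with at most `2^(n-1)` monomial terms. -/
theorem boolean_function_half_representation (n : ℕ) (hn : 1 ≤ n)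
    (f : (Fin n → ZMod 2) → ZMod 2) :
    ∃ (c : ZMod 2) (T : Finset (Fin n → ZMod 2)),
      T.card + c.val ≤ 2 ^ (n - 1) ∧
      ∀ x : Fin n → ZMod 2, f x = c + ∑ a ∈ T, indicatorPoly a x := by
  classical
  have card_split := Finset.card_filter_add_card_filter_not
    (s := (Finset.univ : Finset (Fin n → ZMod 2))) (fun a => f a = 1)
  have card_cube : (Finset.univ : Finset (Fin n → ZMod 2)).card = 2 * 2 ^ (n - 1) := by
    rw [← pow_succ', Nat.sub_add_cancel hn]
    simp [ZMod.card]
  by_cases hS : (Finset.univ.filter fun a => f a = 1).card ≤ 2 ^ (n - 1)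
  · refine ⟨0, Finset.univ.filter fun a => f a = 1, by simpa using hS, fun x => ?_⟩
    rw [sum_indicatorPoly]
    rcases zmod_two_eq_zero_or_one (f x) with h | h <;> simp [h]
  · refine ⟨1, Finset.univ.filter fun a => ¬ f a = 1, ?_, fun x => ?_⟩
    · rw [ZMod.val_one]
      omega
    · rw [sum_indicatorPoly]
      rcases zmod_two_eq_zero_or_one (f x) with h | h <;> simp [h, CharTwo.add_self_eq_zero]
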